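/- For every m ∈ ℕ, the relative tail entropy satisfies the power rule h*(Θ^m) = m·h*(Θ). -/

import Mathlib

open MeasureTheory Set Filter Topology
open scoped ENNReal

namespace RelTail

variable {Ω W : Type*}

/-- The fiber over `ω` of a subset of a product space. -/
def fib (E : Set (Ω × W)) (ω : Ω) : Set W := {x | (ω, x) ∈ E}

/-- Minimal cardinality of a subfamily of the cover `R` whose fibers at `ω` cover the
fiber of `S` at `ω` (with the convention that the empty set needs one element). -/
noncomputable def coverNum (S : Set (Ω × W)) (R : Set (Set (Ω × W))) (ω : Ω) : ℕ :=
  max 1 (sInf {n : ℕ | ∃ F : Finset (Set (Ω × W)), ↑F ⊆ R ∧ F.card = n ∧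
    fib S ω ⊆ ⋃ u ∈ F, fib u ω})

/-- `N(R | Q)(ω) = max_{q ∈ Q} N(q, R)(ω)`. -/
noncomputable def relCoverNum (R Q : Set (Set (Ω × W))) (ω : Ω) : ℕ :=
  ⨆ q ∈ Q, coverNum q R ω

section Meas
variable [MeasurableSpace Ω] [MeasurableSpace W]

/-- A (finite or countable) random cover of `E`. -/
def IsRandomCover (E : Set (Ω × W)) (Q : Set (Set (Ω × W))) : Prop :=
  Q.Countable ∧ (∀ q ∈ Q, MeasurableSet q) ∧ (∀ q ∈ Q, q ⊆ E) ∧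
    ∀ ω, fib E ω ⊆ ⋃ q ∈ Q, fib q ω

/-- An open random cover: a random cover whose fibers are (a.e.) open in the fibers of `E`. -/
def IsOpenRandomCover [TopologicalSpace W] (P : Measure Ω) (E : Set (Ω × W))
    (Q : Set (Set (Ω × W))) : Prop :=
  IsRandomCover E Q ∧
    ∀ q ∈ Q, ∀ᵐ ω ∂P, ∃ U : Set W, IsOpen U ∧ fib q ω = U ∩ fib E ω

end Meas

/-- The join `⋁_{i<n} (Γ^i)^{-1} Q` of a cover (or partition). -/
def iterJoin {Z : Type*} (Γ : Z → Z) (Q : Set (Set Z)) (n : ℕ) : Set (Set Z) :=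
  {s | ∃ f : ℕ → Set Z, (∀ i, f i ∈ Q) ∧ s = ⋂ i ∈ Finset.range n, (Γ^[i]) ⁻¹' (f i)}

/-- `log N(R^{(n)} | Q^{(n)})(ω)`. -/
noncomputable def iterCoverLog (Θ : Ω × W → Ω × W) (R Q : Set (Set (Ω × W))) (n : ℕ)
    (ω : Ω) : ℝ :=
  Real.log (relCoverNum (iterJoin Θ R n) (iterJoin Θ Q n) ω)

/-- The relative tail entropy `h_Θ(R|Q)` of an open random cover `R` w.r.t. a random
cover `Q`, as a limit (limsup) of `(1/n) ∫ log N(R^{(n)}|Q^{(n)}) dP`. -/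
noncomputable def relCoverEnt [MeasurableSpace Ω] (P : Measure Ω) (Θ : Ω × W → Ω × W)
    (R Q : Set (Set (Ω × W))) : ℝ≥0∞ :=
  Filter.atTop.limsup fun n : ℕ => ENNReal.ofReal ((∫ ω, iterCoverLog Θ R Q n ω ∂P) / n)

/-- `h(Θ|Q)`: supremum over all open random covers `R` of `h_Θ(R|Q)`. -/
noncomputable def condTailEnt [MeasurableSpace Ω] [MeasurableSpace W] [TopologicalSpace W]
    (P : Measure Ω) (E : Set (Ω × W)) (Θ : Ω × W → Ω × W) (Q : Set (Set (Ω × W))) : ℝ≥0∞ :=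
  ⨆ R ∈ {R | IsOpenRandomCover P E R}, relCoverEnt P Θ R Q

/-- The relative tail entropy `h*(Θ)`: infimum over all random covers `Q` of `h(Θ|Q)`. -/
noncomputable def tailEnt [MeasurableSpace Ω] [MeasurableSpace W] [TopologicalSpace W]
    (P : Measure Ω) (E : Set (Ω × W)) (Θ : Ω × W → Ω × W) : ℝ≥0∞ :=
  ⨅ Q ∈ {Q | IsRandomCover E Q}, condTailEnt P E Θ Q

/-- The skew product transformation of a bundle RDS. -/
def skew (ϑ : Ω → Ω) (T : Ω → W → W) : Ω × W → Ω × W := fun p => (ϑ p.1, T p.1 p.2)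

/-- A continuous bundle random dynamical system over `(Ω, P, ϑ)` on `E`. -/
structure IsBundleRDS [MeasurableSpace Ω] [MeasurableSpace W] [TopologicalSpace W]
    (P : Measure Ω) (ϑ : Ω → Ω) (E : Set (Ω × W)) (T : Ω → W → W) : Prop where
  measurePreserving : MeasurePreserving ϑ P P
  measurable : Measurable fun p : Ω × W => T p.1 p.2
  mapsTo : ∀ ω, MapsTo (T ω) (fib E ω) (fib E (ϑ ω))
  continuousOn : ∀ᵐ ω ∂P, ContinuousOn (T ω) (fib E ω)

/-- A finite or countable measurable partition of a set `E`. -/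
def IsCountablePartition {Z : Type*} [MeasurableSpace Z] (E : Set Z) (R : Set (Set Z)) : Prop :=
  R.Countable ∧ (∀ s ∈ R, MeasurableSet s) ∧ (∀ s ∈ R, s ⊆ E) ∧
    R.PairwiseDisjoint id ∧ ⋃₀ R = E

/-- The conditional entropy `H_μ(R | m)` of a countable partition `R` given a
sub-σ-algebra `m`, via conditional expectations. -/
noncomputable def partCondEntropy {Z : Type*} (m : MeasurableSpace Z) [MeasurableSpace Z]
    (μ : Measure Z) (R : Set (Set Z)) : ℝ≥0∞ :=
  ∑' r : R, ENNReal.ofReal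
    (∫ z, Real.negMulLog ((μ[(r : Set Z).indicator (fun _ => (1 : ℝ)) | m]) z) ∂μ)

/-- The relative entropy `h_μ(R | m)` of the transformation `Γ` with respect to a
partition `R`, given the sub-σ-algebra `m`. -/
noncomputable def relEntPart {Z : Type*} (m : MeasurableSpace Z) [MeasurableSpace Z]
    (μ : Measure Z) (Γ : Z → Z) (R : Set (Set Z)) : ℝ≥0∞ :=
  Filter.atTop.limsup fun n : ℕ => partCondEntropy m μ (iterJoin Γ R n) / (n : ℝ≥0∞)

/-- The relative entropy `h_μ(Γ | m)` given the sub-σ-algebra `m`: supremum over all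
countable measurable partitions of `E` of finite conditional entropy. -/
noncomputable def relEnt {Z : Type*} (m : MeasurableSpace Z) [MeasurableSpace Z]
    (μ : Measure Z) (Γ : Z → Z) (E : Set Z) : ℝ≥0∞ :=
  ⨆ R ∈ {R | IsCountablePartition E R ∧ partCondEntropy m μ R ≠ ∞}, relEntPart m μ Γ R

/-- The fiberwise boundary `{(ω,x) : x ∈ ∂(R(ω))}` of a subset of a product space. -/
def fibFrontier [TopologicalSpace W] (R : Set (Ω × W)) : Set (Ω × W) :=
  {p | p.2 ∈ frontier (fib R p.1)}

/-- The sub-σ-algebra of `Ω × W₁ × W₂` generated by the first two coordinates,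
i.e. the σ-algebra `{(A × W₂) ∩ ⬝ : A ∈ F × B}`. -/
def firstPairSigma (Ω W₁ W₂ : Type*) [MeasurableSpace Ω] [MeasurableSpace W₁] :
    MeasurableSpace (Ω × W₁ × W₂) :=
  MeasurableSpace.comap (fun p : Ω × W₁ × W₂ => (p.1, p.2.1)) inferInstance

/-- The defect of upper semi-continuity of `f` at `m` relative to the set `S`. -/
noncomputable def uscDefect {M : Type*} [TopologicalSpace M] (f : M → ℝ≥0∞) (S : Set M)
    (m : M) : ℝ≥0∞ :=
  if f m ≠ ∞ then Filter.limsup f (𝓝[S] m) - f m else ∞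

/-- The factor (extension) transformation `(ω, y) ↦ (ω, π_ω y)`. -/
def factorMap {Y X : Type*} (πf : Ω → Y → X) : Ω × Y → Ω × X :=
  fun p => (p.1, πf p.1 p.2)

/-- `T` on `E` is a factor of `S` on `G` via the family `π_ω`. -/
structure IsFactor {Ω X Y : Type*} [MeasurableSpace Ω] [MeasurableSpace X] [MeasurableSpace Y]
    [TopologicalSpace X] [TopologicalSpace Y] (ϑ : Ω → Ω) (E : Set (Ω × X)) (G : Set (Ω × Y))
    (T : Ω → X → X) (S : Ω → Y → Y) (πf : Ω → Y → X) : Prop where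
  measurable : Measurable fun p : Ω × Y => πf p.1 p.2
  mapsTo : ∀ ω, MapsTo (πf ω) (fib G ω) (fib E ω)
  surjOn : ∀ ω, SurjOn (πf ω) (fib G ω) (fib E ω)
  continuousOn : ∀ ω, ContinuousOn (πf ω) (fib G ω)
  semiconj : ∀ ω, ∀ y ∈ fib G ω, πf (ϑ ω) (S ω y) = T ω (πf ω y)

theorem analytic_inner {α : Type*} [TopologicalSpace α] [PolishSpace α] [MeasurableSpace α]
    [BorelSpace α] (μ : Measure α) [IsFiniteMeasure μ] (f : (ℕ → ℕ) → α) (hf : Continuous f)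
    (c : ℝ≥0∞) (hc : c < μ (range f)) :
    ∃ K : Set α, IsCompact K ∧ K ⊆ range f ∧ c ≤ μ K := by
  have step : ∀ (k : ℕ) (D : {D : Set (ℕ → ℕ) // c < μ (f '' D)}),
      ∃ j : ℕ, c < μ (f '' (D.1 ∩ {x | x k ≤ j})) := by
    intro k D
    have hU : f '' D.1 = ⋃ j : ℕ, f '' (D.1 ∩ {x | x k ≤ j}) := by
      rw [← image_iUnion, ← inter_iUnion]
      congr 1
      symm
      apply inter_eq_left.2
      intro x _
      exact mem_iUnion.2 ⟨x k, by simp⟩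
    have hm : Monotone fun j : ℕ => f '' (D.1 ∩ {x | x k ≤ j}) := by
      intro a b hab
      apply image_mono
      apply inter_subset_inter_right
      intro x hx
      exact le_trans hx hab
    have h := D.2
    rw [hU, hm.measure_iUnion] at h
    exact lt_iSup_iff.1 h
  choose J hJ using step
  let D : ℕ → {D : Set (ℕ → ℕ) // c < μ (f '' D)} := fun k =>
    Nat.rec ⟨univ, by rwa [image_univ]⟩ (fun k D => ⟨_, hJ k D⟩) k
  let n : ℕ → ℕ := fun k => J k (D k)
  have hD : ∀ k, (D k).1 = {x | ∀ i < k, x i ≤ n i} := by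
    intro k
    induction k with
    | zero => simp [D]
    | succ k ih =>
      have : (D (k+1)).1 = (D k).1 ∩ {x | x k ≤ n k} := rfl
      rw [this, ih]
      ext x
      simp only [mem_inter_iff, mem_ofPred_eq]
      constructor
      · rintro ⟨h1, h2⟩ i hi
        rcases Nat.lt_succ_iff_lt_or_eq.1 hi with h | rfl
        · exact h1 i h
        · exact h2
      · intro h
        exact ⟨fun i hi => h i (by omega), h k (by omega)⟩
  let K0 : Set (ℕ → ℕ) := {x | ∀ i, x i ∈ Iic (n i)}
  have hK0 : IsCompact K0 := isCompact_pi_infinite fun i => (finite_Iic (n i)).isCompact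
  refine ⟨f '' K0, hK0.image hf, image_subset_range _ _, ?_⟩
  rw [(f '' K0).measure_eq_iInf_isOpen μ]
  refine le_iInf₂ fun U hU => le_iInf fun hUo => ?_
  have key : ∃ k, (D k).1 ⊆ f ⁻¹' U := by
    by_contra hcon
    push Not at hcon
    have : ∀ k, ∃ x, x ∈ (D k).1 ∧ f x ∉ U := fun k => by
      obtain ⟨x, h1, h2⟩ := not_subset.1 (hcon k)
      exact ⟨x, h1, h2⟩
    choose x hx hxU using this
    let y : ℕ → ℕ → ℕ := fun k i => min (x k i) (n i)
    have hy : ∀ k, y k ∈ K0 := fun k i => mem_Iic.2 (min_le_right _ _)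
    obtain ⟨z, hz, φ, hφ, hlim⟩ := hK0.tendsto_subseq hy
    have hlim2 : Tendsto (x ∘ φ) atTop (𝓝 z) := by
      rw [tendsto_pi_nhds] at hlim ⊢
      intro i
      refine (hlim i).congr' ?_
      filter_upwards [eventually_gt_atTop i] with k hk
      have h1 : i < φ k := lt_of_lt_of_le hk (hφ.id_le k)
      have h2 := hx (φ k)
      rw [hD] at h2
      exact min_eq_left (h2 i h1)
    have hmem : f z ∈ Uᶜ := by
      refine hUo.isClosed_compl.mem_of_tendsto ((hf.tendsto z).comp hlim2) ?_
      exact Eventually.of_forall fun k => hxU (φ k)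
    exact hmem (hU ⟨z, hz, rfl⟩)
  obtain ⟨k, hk⟩ := key
  exact (D k).2.le.trans (measure_mono (image_subset_iff.2 hk))

theorem analytic_null {α : Type*} [TopologicalSpace α] [PolishSpace α] [MeasurableSpace α]
    [BorelSpace α] (μ : Measure α) [IsFiniteMeasure μ] (A : Set α) (hA : AnalyticSet A) :
    NullMeasurableSet A μ := by
  rw [AnalyticSet] at hA
  rcases hA with rfl | ⟨f, hf, rfl⟩
  · exact MeasurableSet.empty.nullMeasurableSet
  by_cases h0 : μ (range f) = 0
  · exact NullMeasurableSet.of_null h0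
  obtain ⟨u, -, hu, hlim⟩ := exists_seq_strictMono_tendsto' (pos_iff_ne_zero.2 h0)
  choose K hKc hKs hK using fun n => analytic_inner μ f hf (u n) (hu n).2
  have hm : MeasurableSet (⋃ n, K n) := MeasurableSet.iUnion fun n => (hKc n).measurableSet
  have hle : μ (range f) ≤ μ (⋃ n, K n) :=
    le_of_tendsto' hlim fun n => (hK n).trans (measure_mono (subset_iUnion K n))
  exact hm.nullMeasurableSet.congr
    (ae_eq_of_subset_of_measure_ge (iUnion_subset hKs) hle hm.nullMeasurableSet (measure_ne_top _ _))

theorem proj_meas {Ω X : Type*} [MeasurableSpace Ω] [MeasurableSpace.CountablyGenerated Ω]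
    [TopologicalSpace X] [PolishSpace X] [MeasurableSpace X] [BorelSpace X]
    (P : Measure Ω) [IsProbabilityMeasure P] [P.IsComplete]
    (M : Set (Ω × X)) (hM : MeasurableSet M) : MeasurableSet {ω | ∃ x, (ω, x) ∈ M} := by
  have : SecondCountableTopology (ℕ → Bool) := inferInstance
  have : PolishSpace (ℕ → Bool) := PolishSpace.mk
  have : PolishSpace ((ℕ → Bool) × X) := PolishSpace.mk
  let φ : Ω → ℕ → Bool := MeasurableSpace.mapNatBool Ω
  have hφ : Measurable φ := MeasurableSpace.measurable_mapNatBool Ω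
  have hcom : ∀ s : Set Ω, MeasurableSet s → ∃ t, MeasurableSet t ∧ φ ⁻¹' t = s := by
    have : (inferInstance : MeasurableSpace Ω) ≤ MeasurableSpace.comap φ inferInstance := by
      conv_lhs => rw [← MeasurableSpace.generateFrom_natGeneratingSequence Ω]
      apply MeasurableSpace.generateFrom_le
      rintro _ ⟨n, rfl⟩
      refine ⟨{y | y n}, by measurability, ?_⟩
      ext x
      simp [φ, MeasurableSpace.mapNatBool]
    intro s hs
    exact this s hs
  have hB : ∃ B : Set ((ℕ → Bool) × X), MeasurableSet B ∧ Prod.map φ id ⁻¹' B = M := by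
    have : (inferInstance : MeasurableSpace (Ω × X)) ≤
        MeasurableSpace.comap (Prod.map φ id : Ω × X → (ℕ → Bool) × X) inferInstance := by
      rw [← generateFrom_prod]
      apply MeasurableSpace.generateFrom_le
      rintro _ ⟨s, hs, t, ht, rfl⟩
      obtain ⟨s', hs', rfl⟩ := hcom s hs
      exact ⟨s' ×ˢ t, hs'.prod ht, rfl⟩
    exact this M hM
  obtain ⟨B, hBm, rfl⟩ := hB
  have hA : AnalyticSet (Prod.fst '' B) :=
    hBm.analyticSet.image_of_continuous continuous_fst
  have hN := analytic_null (P.map φ) _ hA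
  have h2 : NullMeasurableSet (φ ⁻¹' (Prod.fst '' B)) P :=
    hN.preimage (hφ.measurePreserving P).quasiMeasurePreserving
  have h3 := h2.measurable_of_complete
  convert h3 using 1
  ext ω
  constructor
  · rintro ⟨x, hx⟩
    exact ⟨_, hx, rfl⟩
  · rintro ⟨⟨a, x⟩, hx, h⟩
    refine ⟨x, ?_⟩
    simp only at h
    subst h
    exact hx

/-- `k` elements of `R` suffice to cover `S` at `ω`. -/
def Cov (S : Set (Ω × W)) (R : Set (Set (Ω × W))) (ω : Ω) (k : ℕ) : Prop :=
  ∃ F : Finset (Set (Ω × W)), ↑F ⊆ R ∧ F.card ≤ k ∧ fib S ω ⊆ ⋃ u ∈ F, fib u ω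

/-- `k` elements of `R` suffice to cover each element of `Q`. -/
def AC (R Q : Set (Set (Ω × W))) (ω : Ω) (k : ℕ) : Prop := ∀ q ∈ Q, Cov q R ω k

theorem mem_fib {S : Set (Ω × W)} {ω : Ω} {x : W} : x ∈ fib S ω ↔ (ω, x) ∈ S := Iff.rfl

theorem Cov.mono {S : Set (Ω × W)} {R : Set (Set (Ω × W))} {ω : Ω} {k l : ℕ}
    (h : Cov S R ω k) (hkl : k ≤ l) : Cov S R ω l := by
  obtain ⟨F, h1, h2, h3⟩ := h
  exact ⟨F, h1, h2.trans hkl, h3⟩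

theorem Cov.refine {S S' : Set (Ω × W)} {R R' : Set (Set (Ω × W))} {ω : Ω} {k : ℕ}
    (h : Cov S R ω k) (hS : fib S' ω ⊆ fib S ω)
    (hR : ∀ u ∈ R, ∃ v ∈ R', fib u ω ⊆ fib v ω) : Cov S' R' ω k := by
  classical
  obtain ⟨F, h1, h2, h3⟩ := h
  choose! g hg hg' using hR
  refine ⟨F.image g, ?_, Finset.card_image_le.trans h2, ?_⟩
  · intro v hv
    obtain ⟨u, hu, rfl⟩ := Finset.mem_image.1 (Finset.mem_coe.1 hv)
    exact hg u (h1 hu)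
  · intro x hx
    obtain ⟨u, hu, hxu⟩ := mem_iUnion₂.1 (h3 (hS hx))
    exact mem_iUnion₂.2 ⟨g u, Finset.mem_image_of_mem g hu, hg' u (h1 hu) hxu⟩

theorem coverNum_le {S : Set (Ω × W)} {R : Set (Set (Ω × W))} {ω : Ω} {k : ℕ}
    (h : Cov S R ω k) : coverNum S R ω ≤ max 1 k := by
  obtain ⟨F, h1, h2, h3⟩ := h
  unfold coverNum
  exact max_le_max le_rfl (le_trans (Nat.sInf_le ⟨F, h1, rfl, h3⟩) h2)

theorem cov_coverNum {S : Set (Ω × W)} {R : Set (Set (Ω × W))} {ω : Ω} {k : ℕ}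
    (h : Cov S R ω k) : Cov S R ω (coverNum S R ω) := by
  obtain ⟨F, h1, h2, h3⟩ := h
  have hne : {n : ℕ | ∃ F : Finset (Set (Ω × W)), ↑F ⊆ R ∧ F.card = n ∧
    fib S ω ⊆ ⋃ u ∈ F, fib u ω}.Nonempty := ⟨_, F, h1, rfl, h3⟩
  obtain ⟨G, g1, g2, g3⟩ := Nat.sInf_mem hne
  exact ⟨G, g1, g2.le.trans (le_max_right _ _), g3⟩

theorem relCoverNum_le {R Q : Set (Set (Ω × W))} {ω : Ω} {k : ℕ}
    (h : AC R Q ω k) : relCoverNum R Q ω ≤ max 1 k :=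
  ciSup_le' fun q => ciSup_le' fun hq => coverNum_le (h q hq)

theorem AC_relCoverNum {R Q : Set (Set (Ω × W))} {ω : Ω} {k : ℕ}
    (h : AC R Q ω k) : AC R Q ω (relCoverNum R Q ω) := by
  intro q hq
  refine (cov_coverNum (h q hq)).mono ?_
  have hb : BddAbove (range fun q => ⨆ (_ : q ∈ Q), coverNum q R ω) := by
    refine ⟨max 1 k, ?_⟩
    rintro _ ⟨q, rfl⟩
    exact ciSup_le' fun hq => coverNum_le (h q hq)
  refine le_trans ?_ (le_ciSup hb q)
  simp [hq]

/-- the regularized covering number -/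
noncomputable def Nm (R Q : Set (Set (Ω × W))) (ω : Ω) : ℕ := max 1 (relCoverNum R Q ω)

theorem one_le_Nm (R Q : Set (Set (Ω × W))) (ω : Ω) : 1 ≤ Nm R Q ω := le_max_left _ _

theorem log_Nm (R Q : Set (Set (Ω × W))) (ω : Ω) :
    Real.log (relCoverNum R Q ω) = Real.log (Nm R Q ω) := by
  unfold Nm
  rcases Nat.eq_zero_or_pos (relCoverNum R Q ω) with h | h
  · simp [h]
  · rw [max_eq_right h]

theorem Nm_le {R Q : Set (Set (Ω × W))} {ω : Ω} {k : ℕ} (hk : 1 ≤ k)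
    (h : AC R Q ω k) : Nm R Q ω ≤ k :=
  max_le hk ((relCoverNum_le h).trans (max_le hk le_rfl))

theorem AC_mono {R Q : Set (Set (Ω × W))} {ω : Ω} {k l : ℕ}
    (h : AC R Q ω k) (hkl : k ≤ l) : AC R Q ω l := fun q hq => (h q hq).mono hkl

theorem AC_Nm {R Q : Set (Set (Ω × W))} {ω : Ω} {k : ℕ}
    (h : AC R Q ω k) : AC R Q ω (Nm R Q ω) :=
  AC_mono (AC_relCoverNum h) (le_max_right _ _)

theorem AC_chain {A R Q : Set (Set (Ω × W))} {ω : Ω} {K L : ℕ} (h : AC A Q ω K)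
    (h' : ∀ q ∈ Q, ∀ u ∈ A, Cov (q ∩ u) R ω L) : AC R Q ω (K * L) := by
  classical
  intro q hq
  obtain ⟨F, h1, h2, h3⟩ := h q hq
  have h'' := h' q hq
  choose! G g1 g2 g3 using h''
  refine ⟨F.biUnion G, ?_, ?_, ?_⟩
  · intro v hv
    obtain ⟨u, hu, hv⟩ := Finset.mem_biUnion.1 (Finset.mem_coe.1 hv)
    exact g1 u (h1 hu) hv
  · refine (Finset.card_biUnion_le_card_mul F G L fun u hu => g2 u (h1 hu)).trans ?_
    exact Nat.mul_le_mul_right _ h2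
  · intro x hx
    obtain ⟨u, hu, hxu⟩ := mem_iUnion₂.1 (h3 hx)
    have : x ∈ fib (q ∩ u) ω := ⟨hx, hxu⟩
    obtain ⟨v, hv, hxv⟩ := mem_iUnion₂.1 (g3 u (h1 hu) this)
    exact mem_iUnion₂.2 ⟨v, Finset.mem_biUnion.2 ⟨u, hu, hv⟩, hxv⟩

section Join
variable {Z : Type*}

theorem mem_join {Γ : Z → Z} {f : ℕ → Set Z} {n : ℕ} {z : Z} :
    z ∈ (⋂ i ∈ Finset.range n, (Γ^[i]) ⁻¹' (f i)) ↔ ∀ i < n, Γ^[i] z ∈ f i := by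
  simp

theorem iterJoin_add (Γ : Z → Z) (Q : Set (Set Z)) (n k : ℕ) (s : Set Z) :
    s ∈ iterJoin Γ Q (n + k) ↔
      ∃ u ∈ iterJoin Γ Q n, ∃ v ∈ iterJoin Γ Q k, s = u ∩ Γ^[n] ⁻¹' v := by
  constructor
  · rintro ⟨f, hf, rfl⟩
    refine ⟨_, ⟨f, hf, rfl⟩, _, ⟨fun i => f (n + i), fun i => hf _, rfl⟩, ?_⟩
    ext z
    rw [mem_inter_iff, mem_preimage, mem_join, mem_join, mem_join]
    constructor
    · intro h
      refine ⟨fun i hi => h i (by omega), fun i hi => ?_⟩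
      rw [← Function.iterate_add_apply, add_comm]
      exact h _ (by omega)
    · rintro ⟨h1, h2⟩ i hi
      by_cases hin : i < n
      · exact h1 i hin
      · have := h2 (i - n) (by omega)
        rw [← Function.iterate_add_apply] at this
        rwa [Nat.sub_add_cancel (by omega), Nat.add_sub_cancel' (by omega)] at this
  · rintro ⟨_, ⟨f, hf, rfl⟩, _, ⟨g, hg, rfl⟩, rfl⟩
    refine ⟨fun i => if i < n then f i else g (i - n), fun i => ?_, ?_⟩
    · dsimp only
      split_ifs
      exacts [hf _, hg _]
    ext z
    rw [mem_inter_iff, mem_preimage, mem_join, mem_join, mem_join]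
    constructor
    · rintro ⟨h1, h2⟩ i hi
      by_cases hin : i < n
      · simp only [hin, if_true]
        exact h1 i hin
      · simp only [hin, if_false]
        have := h2 (i - n) (by omega)
        rw [← Function.iterate_add_apply] at this
        rwa [Nat.sub_add_cancel (by omega)] at this
    · intro h
      constructor
      · intro i hi
        have := h i (by omega)
        simpa only [hi, if_true] using this
      · intro i hi
        have := h (n + i) (by omega)
        rw [← Function.iterate_add_apply, add_comm]
        simpa using this

theorem iterJoin_one (Γ : Z → Z) (Q : Set (Set Z)) : iterJoin Γ Q 1 = Q := by
  ext s
  constructor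
  · rintro ⟨f, hf, rfl⟩
    simpa using hf 0
  · intro hs
    exact ⟨fun _ => s, fun _ => hs, by simp⟩

theorem iterJoin_nonempty {Γ : Z → Z} {Q : Set (Set Z)} {n : ℕ} :
    (iterJoin Γ Q n).Nonempty ↔ Q.Nonempty := by
  constructor
  · rintro ⟨s, f, hf, -⟩
    exact ⟨f 0, hf 0⟩
  · rintro ⟨q, hq⟩
    exact ⟨_, fun _ => q, fun _ => hq, rfl⟩

theorem iterJoin_zero {Γ : Z → Z} {Q : Set (Set Z)} {s : Set Z} :
    s ∈ iterJoin Γ Q 0 ↔ Q.Nonempty ∧ s = univ := by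
  constructor
  · rintro ⟨f, hf, rfl⟩
    exact ⟨⟨f 0, hf 0⟩, by simp⟩
  · rintro ⟨⟨q, hq⟩, rfl⟩
    exact ⟨fun _ => q, fun _ => hq, by simp⟩

theorem iterJoin_mul (Γ : Z → Z) (Q : Set (Set Z)) (m n : ℕ) :
    iterJoin (Γ^[m]) (iterJoin Γ Q m) n = iterJoin Γ Q (m * n) := by
  induction n with
  | zero =>
    ext s
    rw [Nat.mul_zero, iterJoin_zero, iterJoin_zero, iterJoin_nonempty]
  | succ n ih =>
    ext s
    rw [Nat.mul_succ, iterJoin_add, iterJoin_add, ih, iterJoin_one, ← Function.iterate_mul]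

theorem iterJoin_refine {Γ : Z → Z} {R R' : Set (Set Z)} (h : ∀ u ∈ R, ∃ v ∈ R', u ⊆ v)
    (n : ℕ) : ∀ u ∈ iterJoin Γ R n, ∃ v ∈ iterJoin Γ R' n, u ⊆ v := by
  rintro _ ⟨f, hf, rfl⟩
  choose! g hg hg' using h
  refine ⟨_, ⟨fun i => g (f i), fun i => hg _ (hf i), rfl⟩, ?_⟩
  intro z hz
  rw [mem_join] at hz ⊢
  exact fun i hi => hg' _ (hf i) (hz i hi)

theorem iterJoin_head {Γ : Z → Z} {R : Set (Set Z)} {n : ℕ} (hn : 1 ≤ n) :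
    ∀ u ∈ iterJoin Γ R n, ∃ v ∈ R, u ⊆ v := by
  rintro _ ⟨f, hf, rfl⟩
  refine ⟨f 0, hf 0, fun z hz => ?_⟩
  rw [mem_join] at hz
  exact hz 0 hn

/-- join of two covers -/
def J2 (Q R : Set (Set Z)) : Set (Set Z) := {s | ∃ q ∈ Q, ∃ r ∈ R, s = q ∩ r}

theorem iterJoin_J2 {Γ : Z → Z} {Q R : Set (Set Z)} {n : ℕ} {q u : Set Z}
    (hq : q ∈ iterJoin Γ Q n) (hu : u ∈ iterJoin Γ R n) : q ∩ u ∈ iterJoin Γ (J2 Q R) n := by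
  obtain ⟨f, hf, rfl⟩ := hq
  obtain ⟨g, hg, rfl⟩ := hu
  refine ⟨fun i => f i ∩ g i, fun i => ⟨_, hf i, _, hg i, rfl⟩, ?_⟩
  ext z
  rw [mem_inter_iff, mem_join, mem_join, mem_join]
  exact ⟨fun h i hi => ⟨h.1 i hi, h.2 i hi⟩, fun h => ⟨fun i hi => (h i hi).1, fun i hi => (h i hi).2⟩⟩

theorem iterJoin_countable {Γ : Z → Z} {Q : Set (Set Z)} (hQ : Q.Countable) (n : ℕ) :
    (iterJoin Γ Q n).Countable := by
  induction n with
  | zero =>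
    refine (countable_singleton univ).mono ?_
    intro s hs
    exact (iterJoin_zero.1 hs).2
  | succ n ih =>
    have : iterJoin Γ Q (n + 1) ⊆ image2 (fun u v => u ∩ Γ^[n] ⁻¹' v) (iterJoin Γ Q n) Q := by
      intro s hs
      obtain ⟨u, hu, v, hv, rfl⟩ := (iterJoin_add Γ Q n 1 s).1 hs
      rw [iterJoin_one] at hv
      exact ⟨u, hu, v, hv, rfl⟩
    exact (ih.image2 hQ _).mono this

theorem iterJoin_measurable [MeasurableSpace Z] {Γ : Z → Z} (hΓ : Measurable Γ)
    {Q : Set (Set Z)} (hQ : ∀ q ∈ Q, MeasurableSet q) (n : ℕ) :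
    ∀ q ∈ iterJoin Γ Q n, MeasurableSet q := by
  rintro _ ⟨f, hf, rfl⟩
  exact Finset.measurableSet_biInter _ fun i _ => (hΓ.iterate i) (hQ _ (hf i))

end Join

theorem iter_fst {Θ : Ω × W → Ω × W} {ϑ : Ω → Ω} (h : ∀ p, (Θ p).1 = ϑ p.1) (n : ℕ)
    (p : Ω × W) : (Θ^[n] p).1 = ϑ^[n] p.1 := by
  induction n generalizing p with
  | zero => rfl
  | succ n ih => rw [Function.iterate_succ_apply, ih, h, Function.iterate_succ_apply]

theorem iter_mem_fib {Θ : Ω × W → Ω × W} {ϑ : Ω → Ω} (h : ∀ p, (Θ p).1 = ϑ p.1) (n : ℕ)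
    (ω : Ω) (x : W) (S : Set (Ω × W)) :
    Θ^[n] (ω, x) ∈ S ↔ (Θ^[n] (ω, x)).2 ∈ fib S (ϑ^[n] ω) := by
  have := iter_fst h n (ω, x)
  simp only at this
  rw [mem_fib, ← this]

theorem AC_add {Θ : Ω × W → Ω × W} {ϑ : Ω → Ω} (h : ∀ p, (Θ p).1 = ϑ p.1)
    {R Q : Set (Set (Ω × W))} {n k : ℕ} {ω : Ω} {K L : ℕ}
    (h1 : AC (iterJoin Θ R n) (iterJoin Θ Q n) ω K)
    (h2 : AC (iterJoin Θ R k) (iterJoin Θ Q k) (ϑ^[n] ω) L) :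
    AC (iterJoin Θ R (n + k)) (iterJoin Θ Q (n + k)) ω (K * L) := by
  classical
  intro q hq
  obtain ⟨u, hu, v, hv, rfl⟩ := (iterJoin_add _ _ _ _ _).1 hq
  obtain ⟨F, f1, f2, f3⟩ := h1 u hu
  obtain ⟨G, g1, g2, g3⟩ := h2 v hv
  refine ⟨(F ×ˢ G).image fun p => p.1 ∩ Θ^[n] ⁻¹' p.2, ?_, ?_, ?_⟩
  · intro s hs
    obtain ⟨⟨a, b⟩, hab, rfl⟩ := Finset.mem_image.1 (Finset.mem_coe.1 hs)
    rw [Finset.mem_product] at hab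
    exact (iterJoin_add _ _ _ _ _).2 ⟨a, f1 hab.1, b, g1 hab.2, rfl⟩
  · refine Finset.card_image_le.trans ?_
    rw [Finset.card_product]
    exact Nat.mul_le_mul f2 g2
  · rintro x ⟨hx1, hx2⟩
    obtain ⟨a, ha, hxa⟩ := mem_iUnion₂.1 (f3 hx1)
    obtain ⟨b, hb, hxb⟩ := mem_iUnion₂.1 (g3 ((iter_mem_fib h n ω x v).1 hx2))
    refine mem_iUnion₂.2 ⟨a ∩ Θ^[n] ⁻¹' b, ?_, hxa, ?_⟩
    · exact Finset.mem_image.2 ⟨(a, b), Finset.mem_product.2 ⟨ha, hb⟩, rfl⟩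
    · exact (iter_mem_fib h n ω x b).2 hxb

set_option linter.unusedSectionVars false

theorem fekete (a : ℕ → ℝ) (S : ℕ → Prop) (ha : ∀ n, 0 ≤ a n)
    (h0 : ∀ n, 1 ≤ n → ¬ S n → a n = 0)
    (hadd : ∀ n k, S n → S k → S (n + k) ∧ a (n + k) ≤ a n + a k)
    (s : ℕ) (hs : S s) (hs1 : 1 ≤ s) :
    atTop.limsup (fun n : ℕ => ENNReal.ofReal (a n / n)) ≤ ENNReal.ofReal (a s / s) := by
  classical
  have hs0 : (0 : ℝ) < s := by exact_mod_cast hs1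
  have hex : ∀ r, ∃ t, (∃ n, S n ∧ n % s = r) → S t ∧ t % s = r ∧ ∀ n, S n → n % s = r → t ≤ n := by
    intro r
    by_cases h : ∃ n, S n ∧ n % s = r
    · exact ⟨Nat.find h, fun _ => ⟨(Nat.find_spec h).1, (Nat.find_spec h).2,
        fun n h1 h2 => Nat.find_min' h ⟨h1, h2⟩⟩⟩
    · exact ⟨0, fun h' => absurd h' h⟩
  choose t ht using hex
  set C : ℝ := ∑ r ∈ Finset.range s, a (t r) with hC
  have hC0 : 0 ≤ C := Finset.sum_nonneg fun r _ => ha _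
  have hiter : ∀ u, S u → ∀ q : ℕ, S (u + s * q) ∧ a (u + s * q) ≤ a u + q * a s := by
    intro u hu q
    induction q with
    | zero => simp [hu]
    | succ q ih =>
      have := hadd _ _ ih.1 hs
      rw [Nat.mul_succ, ← Nat.add_assoc]
      refine ⟨this.1, ?_⟩
      push_cast
      linarith [this.2, ih.2]
  have hbound : ∀ n : ℕ, 1 ≤ n → a n ≤ n * (a s / s) + C := by
    intro n hn
    have hnn : 0 ≤ (n : ℝ) * (a s / s) := mul_nonneg (Nat.cast_nonneg _) (div_nonneg (ha _) hs0.le)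
    by_cases hS : S n
    · obtain ⟨h1, h2, h3⟩ := ht (n % s) ⟨n, hS, rfl⟩
      have hle := h3 n hS rfl
      have hdvd : s ∣ n - t (n % s) := (Nat.modEq_iff_dvd' hle).1 h2
      obtain ⟨q, hq⟩ := hdvd
      have hnq : n = t (n % s) + s * q := by omega
      have h4 := (hiter _ h1 q).2
      rw [← hnq] at h4
      have h5 : a (t (n % s)) ≤ C :=
        Finset.single_le_sum (f := fun r => a (t r)) (fun r _ => ha _)
          (Finset.mem_range.2 (Nat.mod_lt _ hs1))
      have h6 : (q : ℝ) * a s ≤ n * (a s / s) := by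
        have h7 : (s : ℝ) * q ≤ n := by
          have : s * q ≤ n := by omega
          exact_mod_cast this
        have : (q : ℝ) * a s = (s * q) * (a s / s) := by field_simp
        rw [this]
        exact mul_le_mul_of_nonneg_right h7 (div_nonneg (ha _) hs0.le)
      linarith
    · rw [h0 n hn hS]
      linarith
  have hlim : Tendsto (fun n : ℕ => ENNReal.ofReal (a s / s + C / n)) atTop
      (𝓝 (ENNReal.ofReal (a s / s))) := by
    apply ENNReal.tendsto_ofReal
    have := (tendsto_const_div_atTop_nhds_zero_nat C).const_add (a s / s)
    simpa using this
  rw [← hlim.limsup_eq]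
  refine limsup_le_limsup ?_
  filter_upwards [eventually_ge_atTop 1] with n hn
  apply ENNReal.ofReal_le_ofReal
  have hn0 : (0 : ℝ) < n := by exact_mod_cast hn
  rw [div_le_iff₀ hn0]
  have := hbound n hn
  have h2 : (a s / s + C / n) * n = n * (a s / s) + C := by field_simp
  linarith

theorem limsup_mul_le (g : ℕ → ℝ≥0∞) {m : ℕ} (hm : 1 ≤ m) :
    atTop.limsup (fun n : ℕ => g (m * n)) ≤ atTop.limsup g := by
  have ht : Tendsto (fun n : ℕ => m * n) atTop atTop := tendsto_id.const_mul_atTop' hm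
  have : (fun n : ℕ => g (m * n)) = g ∘ fun n : ℕ => m * n := rfl
  rw [this, limsup_comp]
  exact limsup_le_limsup_of_le ht

/-- Abstract skew-product system. -/
structure Sys {X : Type*} [MeasurableSpace Ω] [MeasurableSpace X] [TopologicalSpace X]
    (P : Measure Ω) (ϑ : Ω → Ω) (E : Set (Ω × X)) (Θ : Ω × X → Ω × X) : Prop where
  fst : ∀ p, (Θ p).1 = ϑ p.1
  mp : MeasurePreserving ϑ P P
  meas : Measurable Θ
  maps : MapsTo Θ E E
  cont : ∀ᵐ ω ∂P, ContinuousOn (fun x => (Θ (ω, x)).2) (fib E ω)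

section SysLemmas
variable {X : Type*} [MeasurableSpace Ω] [TopologicalSpace X] [MeasurableSpace X]
  {P : Measure Ω} {ϑ : Ω → Ω} {E : Set (Ω × X)} {Θ : Ω × X → Ω × X} {R Q : Set (Set (Ω × X))}

theorem Sys.cont_iter (h : Sys P ϑ E Θ) (m : ℕ) :
    ∀ᵐ ω ∂P, ContinuousOn (fun x => (Θ^[m] (ω, x)).2) (fib E ω) := by
  induction m with
  | zero =>
    refine Eventually.of_forall fun ω => ?_
    exact continuousOn_id
  | succ m ih =>
    have h2 := (h.mp.iterate m).quasiMeasurePreserving.ae h.cont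
    filter_upwards [ih, h2] with ω h1 h2
    have : (fun x => (Θ^[m+1] (ω, x)).2) =
        (fun y => (Θ (ϑ^[m] ω, y)).2) ∘ fun x => (Θ^[m] (ω, x)).2 := by
      funext x
      have h3 := iter_fst h.fst m (ω, x)
      simp only at h3
      rw [Function.iterate_succ_apply', Function.comp_apply, ← h3]
    rw [this]
    refine h2.comp h1 ?_
    intro x hx
    exact (iter_mem_fib h.fst m ω x E).1 (h.maps.iterate m hx)

theorem Sys.iterate (h : Sys P ϑ E Θ) (m : ℕ) : Sys P (ϑ^[m]) E (Θ^[m]) where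
  fst := iter_fst h.fst m
  mp := h.mp.iterate m
  meas := h.meas.iterate m
  maps := h.maps.iterate m
  cont := h.cont_iter m

theorem Sys.join_cover (h : Sys P ϑ E Θ) (hQ : IsRandomCover E Q) {m : ℕ} (hm : 1 ≤ m) :
    IsRandomCover E (iterJoin Θ Q m) := by
  obtain ⟨h1, h2, h3, h4⟩ := hQ
  refine ⟨iterJoin_countable h1 m, iterJoin_measurable h.meas h2 m, ?_, ?_⟩
  · intro q hq
    obtain ⟨v, hv, hqv⟩ := iterJoin_head hm q hq
    exact hqv.trans (h3 v hv)
  · intro ω x hx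
    have : ∀ i, ∃ q ∈ Q, Θ^[i] (ω, x) ∈ q := by
      intro i
      have := h4 (ϑ^[i] ω) ((iter_mem_fib h.fst i ω x E).1 (h.maps.iterate i hx))
      obtain ⟨q, hq, hxq⟩ := mem_iUnion₂.1 this
      exact ⟨q, hq, (iter_mem_fib h.fst i ω x q).2 hxq⟩
    choose f hf hf' using this
    refine mem_iUnion₂.2 ⟨_, ⟨f, hf, rfl⟩, ?_⟩
    exact mem_join.2 fun i _ => hf' i

theorem Sys.join_open (h : Sys P ϑ E Θ) (hQ : IsOpenRandomCover P E Q) {m : ℕ} (hm : 1 ≤ m) :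
    IsOpenRandomCover P E (iterJoin Θ Q m) := by
  refine ⟨h.join_cover hQ.1 hm, ?_⟩
  rintro _ ⟨f, hf, rfl⟩
  have h1 : ∀ᵐ ω ∂P, ∀ i, ContinuousOn (fun x => (Θ^[i] (ω, x)).2) (fib E ω) :=
    ae_all_iff.2 h.cont_iter
  have h2 : ∀ᵐ ω ∂P, ∀ i, ∃ U : Set X, IsOpen U ∧ fib (f i) (ϑ^[i] ω) = U ∩ fib E (ϑ^[i] ω) :=
    ae_all_iff.2 fun i => (h.mp.iterate i).quasiMeasurePreserving.ae (hQ.2 _ (hf i))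
  filter_upwards [h1, h2] with ω h1 h2
  choose U hU hU' using h2
  have h3 := fun i => continuousOn_iff'.1 (h1 i) (U i) (hU i)
  choose V hV hV' using h3
  refine ⟨⋂ i ∈ Finset.range m, V i, isOpen_biInter_finset fun i _ => hV i, ?_⟩
  ext x
  rw [mem_fib, mem_join]
  have key : x ∈ fib E ω → ∀ i, (Θ^[i] (ω, x) ∈ f i ↔ x ∈ V i) := by
    intro hx i
    rw [iter_mem_fib h.fst i ω x (f i), hU' i]
    have h5 := (iter_mem_fib h.fst i ω x E).1 (h.maps.iterate i hx)
    have h6 : x ∈ (fun x => (Θ^[i] (ω, x)).2) ⁻¹' U i ∩ fib E ω ↔ x ∈ V i ∩ fib E ω := by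
      rw [hV' i]
    constructor
    · intro h7
      exact (h6.1 ⟨h7.1, hx⟩).1
    · intro h7
      exact ⟨(h6.2 ⟨h7, hx⟩).1, h5⟩
  constructor
  · intro h4
    have hx : x ∈ fib E ω := hQ.1.2.2.1 _ (hf 0) (h4 0 hm)
    refine ⟨?_, hx⟩
    simp only [Finset.mem_range, mem_iInter]
    exact fun i hi => (key hx i).1 (h4 i hi)
  · rintro ⟨h4, hx⟩ i hi
    simp only [Finset.mem_range, mem_iInter] at h4
    exact (key hx i).2 (h4 i hi)

theorem AC_prod (h : ∀ p, (Θ p).1 = ϑ p.1) (hQ : ∀ q ∈ Q, q ⊆ E) {κ : ℕ → ℕ} {ω : Ω}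
    (hκ : ∀ i, Cov E R (ϑ^[i] ω) (κ i)) (n : ℕ) (hn : 1 ≤ n) :
    AC (iterJoin Θ R n) (iterJoin Θ Q n) ω (∏ i ∈ Finset.range n, κ i) := by
  have hone : ∀ i, AC (iterJoin Θ R 1) (iterJoin Θ Q 1) (ϑ^[i] ω) (κ i) := by
    intro i
    rw [iterJoin_one, iterJoin_one]
    intro q hq
    exact (hκ i).refine (fun x hx => hQ q hq hx) fun u hu => ⟨u, hu, le_rfl⟩
  induction n, hn using Nat.le_induction with
  | base => simpa using hone 0
  | succ n hn ih =>
    rw [Finset.prod_range_succ]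
    exact AC_add h ih (hone n)

theorem Sys.ae_orbit (h : Sys P ϑ E Θ) {p : Ω → Prop} (hp : ∀ᵐ ω ∂P, p ω) :
    ∀ᵐ ω ∂P, ∀ i, p (ϑ^[i] ω) :=
  ae_all_iff.2 fun i => (h.mp.iterate i).quasiMeasurePreserving.ae hp

theorem Sys.ae_AC (h : Sys P ϑ E Θ) (hQ : ∀ q ∈ Q, q ⊆ E) (hfin : ∀ᵐ ω ∂P, ∃ K, Cov E R ω K) :
    ∀ᵐ ω ∂P, ∀ n, 1 ≤ n → ∀ i, ∃ K, AC (iterJoin Θ R n) (iterJoin Θ Q n) (ϑ^[i] ω) K := by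
  filter_upwards [h.ae_orbit (h.ae_orbit hfin)] with ω hω n hn i
  have := hω i
  choose κ hκ using this
  exact ⟨_, AC_prod h.fst hQ hκ n hn⟩

theorem icl_eq (n : ℕ) (ω : Ω) : iterCoverLog Θ R Q n ω =
    Real.log (Nm (iterJoin Θ R n) (iterJoin Θ Q n) ω) := log_Nm _ _ _

theorem icl_nonneg (n : ℕ) (ω : Ω) : 0 ≤ iterCoverLog Θ R Q n ω := by
  rw [icl_eq]
  exact Real.log_natCast_nonneg _

theorem icl_le {n : ℕ} {ω : Ω} {K : ℕ} (hK : 1 ≤ K)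
    (h : AC (iterJoin Θ R n) (iterJoin Θ Q n) ω K) : iterCoverLog Θ R Q n ω ≤ Real.log K := by
  rw [icl_eq]
  apply Real.log_le_log
  · exact_mod_cast one_le_Nm _ _ _
  · exact_mod_cast Nm_le hK h

theorem Sys.sub (h : Sys P ϑ E Θ) (hQ : ∀ q ∈ Q, q ⊆ E) (hfin : ∀ᵐ ω ∂P, ∃ K, Cov E R ω K)
    {n k : ℕ} (hn : 1 ≤ n) (hk : 1 ≤ k) : ∀ᵐ ω ∂P, iterCoverLog Θ R Q (n + k) ω ≤
      iterCoverLog Θ R Q n ω + iterCoverLog Θ R Q k (ϑ^[n] ω) := by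
  filter_upwards [h.ae_AC hQ hfin] with ω hω
  obtain ⟨K, hK⟩ := hω n hn 0
  obtain ⟨L, hL⟩ := hω k hk n
  have h3 := icl_le (one_le_mul (one_le_Nm _ _ _) (one_le_Nm _ _ _))
    (AC_add h.fst (AC_Nm hK) (AC_Nm hL))
  refine h3.trans ?_
  rw [icl_eq, icl_eq, Nat.cast_mul, Real.log_mul]
  · rfl
  · exact Nat.cast_ne_zero.2 (Nat.one_le_iff_ne_zero.1 (one_le_Nm _ _ _))
  · exact Nat.cast_ne_zero.2 (Nat.one_le_iff_ne_zero.1 (one_le_Nm _ _ _))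

end SysLemmas

section MeasLemmas
variable {X : Type*} [MeasurableSpace Ω] [MeasurableSpace.CountablyGenerated Ω]
  [TopologicalSpace X] [PolishSpace X] [MeasurableSpace X] [BorelSpace X]
  {P : Measure Ω} [IsProbabilityMeasure P] [P.IsComplete]
  {ϑ : Ω → Ω} {E : Set (Ω × X)} {Θ : Ω × X → Ω × X} {R Q : Set (Set (Ω × X))}

theorem meas_cov (P : Measure Ω) [IsProbabilityMeasure P] [P.IsComplete]
    {S : Set (Ω × X)} (hS : MeasurableSet S) (F : Finset (Set (Ω × X)))
    (hF : ∀ u ∈ F, MeasurableSet u) : MeasurableSet {ω | fib S ω ⊆ ⋃ u ∈ F, fib u ω} := by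
  have h1 : MeasurableSet (S \ ⋃ u ∈ F, u) := hS.diff (Finset.measurableSet_biUnion _ hF)
  have h2 := (proj_meas P _ h1).compl
  convert h2 using 1
  ext ω
  simp only [mem_ofPred_eq, mem_compl_iff, not_exists, Set.mem_sdiff, not_and, not_not, subset_def,
    mem_iUnion, mem_fib, exists_prop, not_forall]

theorem meas_AC (P : Measure Ω) [IsProbabilityMeasure P] [P.IsComplete]
    (hR : R.Countable) (hRm : ∀ u ∈ R, MeasurableSet u)
    (hQ : Q.Countable) (hQm : ∀ u ∈ Q, MeasurableSet u) (k : ℕ) :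
    MeasurableSet {ω | AC R Q ω k} := by
  have hc : {F : Finset (Set (Ω × X)) | (F : Set (Set (Ω × X))) ⊆ R ∧ F.card ≤ k}.Countable := by
    have := (countable_ofPred_finite_subset hR).preimage_of_injOn
      (f := fun F : Finset (Set (Ω × X)) => (F : Set (Set (Ω × X)))) Finset.coe_injective.injOn
    refine this.mono ?_
    rintro F ⟨hF, -⟩
    exact ⟨F.finite_toSet, hF⟩
  have : {ω | AC R Q ω k} = ⋂ q ∈ Q, ⋃ F ∈ {F : Finset (Set (Ω × X)) |
      (F : Set (Set (Ω × X))) ⊆ R ∧ F.card ≤ k}, {ω | fib q ω ⊆ ⋃ u ∈ F, fib u ω} := by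
    ext ω
    simp only [AC, Cov, mem_ofPred_eq, mem_iInter, mem_iUnion, exists_prop, and_assoc]
  rw [this]
  refine MeasurableSet.biInter hQ fun q hq => MeasurableSet.biUnion hc fun F hF => ?_
  exact meas_cov P (hQm q hq) F fun u hu => hRm u (hF.1 hu)

theorem meas_Nm (P : Measure Ω) [IsProbabilityMeasure P] [P.IsComplete]
    (hR : R.Countable) (hRm : ∀ u ∈ R, MeasurableSet u)
    (hQ : Q.Countable) (hQm : ∀ u ∈ Q, MeasurableSet u)
    (hfin : ∀ᵐ ω ∂P, ∃ K, AC R Q ω K) : Measurable (Nm R Q) := by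
  refine measurable_of_Iic fun k => ?_
  rcases Nat.eq_zero_or_pos k with rfl | hk
  · convert MeasurableSet.empty
    ext ω
    have := one_le_Nm R Q ω
    simp only [mem_preimage, mem_Iic, mem_empty_iff_false, iff_false]
    omega
  · have h1 := (meas_AC P hR hRm hQ hQm k).nullMeasurableSet (μ := P)
    refine (h1.congr ?_).measurable_of_complete
    rw [eventuallyEq_set]
    filter_upwards [hfin] with ω ⟨K, hK⟩
    exact ⟨fun h => Nm_le hk h, fun h => AC_mono (AC_Nm hK) h⟩

theorem Sys.meas_icl (h : Sys P ϑ E Θ) (hR : IsRandomCover E R) (hQ : IsRandomCover E Q)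
    (hfin : ∀ᵐ ω ∂P, ∃ K, Cov E R ω K) {n : ℕ} (hn : 1 ≤ n) :
    Measurable (iterCoverLog Θ R Q n) := by
  have h1 : iterCoverLog Θ R Q n = fun ω => Real.log (Nm (iterJoin Θ R n) (iterJoin Θ Q n) ω) :=
    funext fun ω => icl_eq n ω
  rw [h1]
  have hm : Measurable (Nm (iterJoin Θ R n) (iterJoin Θ Q n)) := by
    refine meas_Nm P (iterJoin_countable hR.1 n) (iterJoin_measurable h.meas hR.2.1 n)
      (iterJoin_countable hQ.1 n) (iterJoin_measurable h.meas hQ.2.1 n) ?_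
    filter_upwards [h.ae_AC hQ.2.2.1 hfin] with ω hω
    exact hω n hn 0
  exact Real.measurable_log.comp (measurable_from_top.comp hm)

theorem Sys.int_comp (h : Sys P ϑ E Θ) (hR : IsRandomCover E R) (hQ : IsRandomCover E Q)
    (hfin : ∀ᵐ ω ∂P, ∃ K, Cov E R ω K) {k : ℕ} (hk : 1 ≤ k) (n : ℕ) :
    ∫ ω, iterCoverLog Θ R Q k (ϑ^[n] ω) ∂P = ∫ ω, iterCoverLog Θ R Q k ω ∂P := by
  have hmp := h.mp.iterate n
  conv_rhs => rw [← hmp.map_eq]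
  rw [integral_map hmp.measurable.aemeasurable]
  exact (h.meas_icl hR hQ hfin hk).aestronglyMeasurable

theorem Sys.int_add (h : Sys P ϑ E Θ) (hR : IsRandomCover E R) (hQ : IsRandomCover E Q)
    (hfin : ∀ᵐ ω ∂P, ∃ K, Cov E R ω K) {n k : ℕ} (hn : 1 ≤ n) (hk : 1 ≤ k)
    (h1 : Integrable (iterCoverLog Θ R Q n) P) (h2 : Integrable (iterCoverLog Θ R Q k) P) :
    Integrable (iterCoverLog Θ R Q (n + k)) P ∧
    ∫ ω, iterCoverLog Θ R Q (n + k) ω ∂P ≤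
      ∫ ω, iterCoverLog Θ R Q n ω ∂P + ∫ ω, iterCoverLog Θ R Q k ω ∂P := by
  have h3 : Integrable (fun ω => iterCoverLog Θ R Q k (ϑ^[n] ω)) P :=
    (h.mp.iterate n).integrable_comp_of_integrable h2
  have hsub := h.sub hQ.2.2.1 hfin hn hk
  have h4 : Integrable (iterCoverLog Θ R Q (n + k)) P := by
    refine (h1.add h3).mono' (h.meas_icl hR hQ hfin (by omega)).aestronglyMeasurable ?_
    filter_upwards [hsub] with ω hω
    rw [Real.norm_of_nonneg (icl_nonneg _ _)]
    exact hω
  refine ⟨h4, ?_⟩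
  rw [← h.int_comp hR hQ hfin hk n, ← integral_add h1 h3]
  exact integral_mono_ae h4 (h1.add h3) hsub

theorem Sys.ent_le (h : Sys P ϑ E Θ) (hR : IsRandomCover E R) (hQ : IsRandomCover E Q)
    (hfin : ∀ᵐ ω ∂P, ∃ K, Cov E R ω K) {s : ℕ} (hs : 1 ≤ s)
    (h1 : Integrable (iterCoverLog Θ R Q s) P) :
    relCoverEnt P Θ R Q ≤ ENNReal.ofReal ((∫ ω, iterCoverLog Θ R Q s ω ∂P) / s) := by
  refine fekete (fun n => ∫ ω, iterCoverLog Θ R Q n ω ∂P)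
    (fun n => 1 ≤ n ∧ Integrable (iterCoverLog Θ R Q n) P) ?_ ?_ ?_ s ⟨hs, h1⟩ hs
  · exact fun n => integral_nonneg fun ω => icl_nonneg _ _
  · intro n hn hS
    exact integral_undef fun h' => hS ⟨hn, h'⟩
  · rintro n k ⟨hn, hn'⟩ ⟨hk, hk'⟩
    obtain ⟨h3, h4⟩ := h.int_add hR hQ hfin hn hk hn' hk'
    exact ⟨⟨by omega, h3⟩, h4⟩

theorem Sys.bdd_int (h : Sys P ϑ E Θ) (hR : IsRandomCover E R) (hQ : IsRandomCover E Q)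
    {K : ℕ} (hfin : ∀ᵐ ω ∂P, Cov E R ω K) {n : ℕ} (hn : 1 ≤ n) :
    Integrable (iterCoverLog Θ R Q n) P := by
  refine Integrable.of_bound (h.meas_icl hR hQ (hfin.mono fun ω hω => ⟨K, hω⟩)
    hn).aestronglyMeasurable (Real.log ((max 1 K ^ n : ℕ) : ℝ)) ?_
  filter_upwards [h.ae_orbit hfin] with ω hω
  rw [Real.norm_of_nonneg (icl_nonneg _ _)]
  apply icl_le (Nat.one_le_pow _ _ (by positivity))
  have := AC_prod h.fst hQ.2.2.1 (κ := fun _ => max 1 K)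
    (fun i => (hω i).mono (le_max_right _ _)) n hn
  simpa using this

theorem ent_mono {R' Q' : Set (Set (Ω × X))}
    (hint : ∀ n, 1 ≤ n → Integrable (iterCoverLog Θ R' Q' n) P)
    (hle : ∀ n, 1 ≤ n → ∀ᵐ ω ∂P, iterCoverLog Θ R Q n ω ≤ iterCoverLog Θ R' Q' n ω) :
    relCoverEnt P Θ R Q ≤ relCoverEnt P Θ R' Q' := by
  refine limsup_le_limsup ?_
  filter_upwards [eventually_ge_atTop 1] with n hn
  apply ENNReal.ofReal_le_ofReal
  refine div_le_div_of_nonneg_right ?_ (Nat.cast_nonneg _)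
  exact integral_mono_of_nonneg (Eventually.of_forall fun ω => icl_nonneg _ _) (hint n hn) (hle n hn)

theorem Sys.ent_refine (h : Sys P ϑ E Θ) {R' Q' : Set (Set (Ω × X))} (hR' : IsRandomCover E R')
    (hQ' : IsRandomCover E Q') {K : ℕ} (hfin : ∀ᵐ ω ∂P, Cov E R' ω K)
    (hRR : ∀ u ∈ R', ∃ v ∈ R, u ⊆ v) (hQQ : ∀ u ∈ Q, ∃ v ∈ Q', u ⊆ v) :
    relCoverEnt P Θ R Q ≤ relCoverEnt P Θ R' Q' := by
  refine ent_mono (fun n hn => h.bdd_int hR' hQ' hfin hn) fun n hn => ?_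
  filter_upwards [h.ae_AC hQ'.2.2.1 (hfin.mono fun ω hω => ⟨K, hω⟩)] with ω hω
  obtain ⟨L, hL⟩ := hω n hn 0
  rw [icl_eq (R := R')]
  refine icl_le (one_le_Nm _ _ _) ?_
  intro q hq
  obtain ⟨v, hv, hqv⟩ := iterJoin_refine hQQ n q hq
  refine (AC_Nm hL v hv).refine (fun x hx => hqv hx) fun u hu => ?_
  obtain ⟨w, hw, huw⟩ := iterJoin_refine hRR n u hu
  exact ⟨w, hw, fun x hx => huw hx⟩

theorem Sys.ent_pow (h : Sys P ϑ E Θ) (hR : IsRandomCover E R) (hQ : IsRandomCover E Q)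
    {K : ℕ} (hfin : ∀ᵐ ω ∂P, Cov E R ω K) {m : ℕ} (hm : 1 ≤ m) :
    relCoverEnt P (Θ^[m]) (iterJoin Θ R m) (iterJoin Θ Q m) = m * relCoverEnt P Θ R Q := by
  have hm0 : (0 : ℝ) < m := by exact_mod_cast hm
  have heq : ∀ n : ℕ, ENNReal.ofReal ((∫ ω, iterCoverLog (Θ^[m]) (iterJoin Θ R m)
      (iterJoin Θ Q m) n ω ∂P) / n) =
      m * ENNReal.ofReal ((∫ ω, iterCoverLog Θ R Q (m * n) ω ∂P) / (m * n : ℕ)) := by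
    intro n
    have : iterCoverLog (Θ^[m]) (iterJoin Θ R m) (iterJoin Θ Q m) n =
        iterCoverLog Θ R Q (m * n) := by
      funext ω
      unfold iterCoverLog
      rw [iterJoin_mul, iterJoin_mul]
    rw [this, ← ENNReal.ofReal_natCast m, ← ENNReal.ofReal_mul hm0.le]
    congr 1
    push_cast
    field_simp
  apply le_antisymm
  · unfold relCoverEnt
    simp_rw [heq]
    rw [ENNReal.limsup_const_mul_of_ne_top (ENNReal.natCast_ne_top m)]
    gcongr
    exact limsup_mul_le (fun n : ℕ => ENNReal.ofReal ((∫ ω, iterCoverLog Θ R Q n ω ∂P) / n)) hm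
  · refine le_limsup_of_frequently_le (Eventually.frequently ?_) (by isBoundedDefault)
    filter_upwards [eventually_ge_atTop 1] with n hn
    rw [heq]
    have hmn : 1 ≤ m * n := one_le_mul hm hn
    have h7 := h.ent_le hR hQ (hfin.mono fun ω hω => ⟨K, hω⟩) hmn (h.bdd_int hR hQ hfin hmn)
    exact mul_le_mul_right h7 _

end MeasLemmas

section Red
variable {X : Type*} [MeasurableSpace Ω] [MeasurableSpace.CountablyGenerated Ω]
  [TopologicalSpace X] [PolishSpace X] [MeasurableSpace X] [BorelSpace X]
  {P : Measure Ω} [IsProbabilityMeasure P] [P.IsComplete]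
  {ϑ : Ω → Ω} {E : Set (Ω × X)} {Θ : Ω × X → Ω × X} {R Q : Set (Set (Ω × X))}

theorem triv_cover (P : Measure Ω) (hE : MeasurableSet E) : IsOpenRandomCover P E {E} := by
  refine ⟨⟨countable_singleton _, ?_, ?_, ?_⟩, ?_⟩
  · rintro q rfl; exact hE
  · rintro q rfl; exact le_rfl
  · intro ω; simp
  · rintro q rfl
    exact Eventually.of_forall fun ω => ⟨univ, isOpen_univ, by simp⟩

theorem triv_cov (ω : Ω) : Cov E {E} ω 1 := ⟨{E}, by simp, by simp, by simp⟩

theorem fin_cov (hEc : ∀ ω, IsCompact (fib E ω)) (hR : IsOpenRandomCover P E R) :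
    ∀ᵐ ω ∂P, ∃ K, Cov E R ω K := by
  have h1 : ∀ᵐ ω ∂P, ∀ q ∈ R, ∃ U : Set X, IsOpen U ∧ fib q ω = U ∩ fib E ω :=
    (ae_ball_iff hR.1.1).2 hR.2
  filter_upwards [h1] with ω hω
  choose! U hU hU' using hω
  obtain ⟨b, hb, hbf, hcov⟩ := (hEc ω).elim_finite_subcover_image hU (by
    intro x hx
    obtain ⟨q, hq, hxq⟩ := mem_iUnion₂.1 (hR.1.2.2.2 ω hx)
    rw [hU' q hq] at hxq
    exact mem_iUnion₂.2 ⟨q, hq, hxq.1⟩)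
  refine ⟨hbf.toFinset.card, hbf.toFinset, by simpa using hb, le_rfl, ?_⟩
  intro x hx
  obtain ⟨q, hq, hxq⟩ := mem_iUnion₂.1 (hcov hx)
  refine mem_iUnion₂.2 ⟨q, by simpa using hq, ?_⟩
  rw [hU' q (hb hq)]
  exact ⟨hxq, hx⟩

/-- truncation of a cover outside a set of base points -/
def trunc (E : Set (Ω × X)) (R : Set (Set (Ω × X))) (A : Set Ω) : Set (Set (Ω × X)) :=
  (fun r => r ∩ Prod.fst ⁻¹' A) '' R ∪ {E ∩ Prod.fst ⁻¹' Aᶜ}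

theorem trunc_open (hE : MeasurableSet E) (hR : IsOpenRandomCover P E R) {A : Set Ω}
    (hA : MeasurableSet A) : IsOpenRandomCover P E (trunc E R A) := by
  refine ⟨⟨(hR.1.1.image _).union (countable_singleton _), ?_, ?_, ?_⟩, ?_⟩
  · rintro q (⟨r, hr, rfl⟩ | rfl)
    · exact (hR.1.2.1 r hr).inter (measurable_fst hA)
    · exact hE.inter (measurable_fst hA.compl)
  · rintro q (⟨r, hr, rfl⟩ | rfl)
    · exact inter_subset_left.trans (hR.1.2.2.1 r hr)
    · exact inter_subset_left
  · intro ω x hx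
    by_cases hω : ω ∈ A
    · obtain ⟨r, hr, hxr⟩ := mem_iUnion₂.1 (hR.1.2.2.2 ω hx)
      exact mem_iUnion₂.2 ⟨_, Or.inl ⟨r, hr, rfl⟩, hxr, hω⟩
    · exact mem_iUnion₂.2 ⟨_, Or.inr rfl, hx, hω⟩
  · rintro q (⟨r, hr, rfl⟩ | rfl)
    · filter_upwards [hR.2 r hr] with ω ⟨U, hU, hU'⟩
      by_cases hω : ω ∈ A
      · refine ⟨U, hU, ?_⟩
        rw [← hU']
        ext x
        exact ⟨fun h => h.1, fun h => ⟨h, hω⟩⟩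
      · refine ⟨∅, isOpen_empty, ?_⟩
        ext x
        exact ⟨fun h => absurd h.2 hω, fun h => absurd h.1 (notMem_empty x)⟩
    · refine Eventually.of_forall fun ω => ?_
      by_cases hω : ω ∈ A
      · refine ⟨∅, isOpen_empty, ?_⟩
        ext x
        exact ⟨fun h => absurd hω h.2, fun h => absurd h.1 (notMem_empty x)⟩
      · refine ⟨univ, isOpen_univ, ?_⟩
        ext x
        exact ⟨fun h => ⟨mem_univ _, h.1⟩, fun h => ⟨h.2, hω⟩⟩

theorem trunc_cov {A : Set Ω} {k : ℕ} (hA : ∀ ω ∈ A, Cov E R ω k) (ω : Ω) :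
    Cov E (trunc E R A) ω (k + 1) := by
  classical
  by_cases hω : ω ∈ A
  · refine ((hA ω hω).refine le_rfl fun u hu => ⟨_, Or.inl ⟨u, hu, rfl⟩, ?_⟩).mono (Nat.le_succ k)
    intro x hx
    exact ⟨hx, hω⟩
  · refine ⟨{E ∩ Prod.fst ⁻¹' Aᶜ}, ?_, by simp, ?_⟩
    · intro u hu
      right
      simpa using hu
    · intro x hx
      exact mem_iUnion₂.2 ⟨_, Finset.mem_singleton_self _, hx, hω⟩

/-- on good orbit pieces one element suffices -/
theorem trunc_good (h : ∀ p, (Θ p).1 = ϑ p.1) (hne : R.Nonempty) {A : Set Ω} {s : ℕ} {ω : Ω}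
    (hω : ∀ i < s, ϑ^[i] ω ∈ A) :
    AC (iterJoin Θ R s) (iterJoin Θ (J2 Q (trunc E R A)) s) ω 1 := by
  obtain ⟨r0, hr0⟩ := hne
  rintro _ ⟨f, hf, rfl⟩
  have : ∀ i, ∃ r ∈ R, i < s → fib (f i) (ϑ^[i] ω) ⊆ fib r (ϑ^[i] ω) := by
    intro i
    obtain ⟨q, hq, u, hu, hfi⟩ := hf i
    rcases hu with ⟨r, hr, rfl⟩ | rfl
    · refine ⟨r, hr, fun _ x hx => ?_⟩
      rw [hfi] at hx
      exact hx.2.1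
    · refine ⟨r0, hr0, fun hi x hx => ?_⟩
      rw [hfi] at hx
      exact absurd (hω i hi) hx.2.2
  choose g hg hg' using this
  refine ⟨{⋂ i ∈ Finset.range s, Θ^[i] ⁻¹' g i}, ?_, by simp, ?_⟩
  · intro u hu
    have hu' : u = ⋂ i ∈ Finset.range s, Θ^[i] ⁻¹' g i := by simpa using hu
    exact ⟨g, hg, hu'⟩
  · intro x hx
    refine mem_iUnion₂.2 ⟨_, Finset.mem_singleton_self _, ?_⟩
    rw [mem_fib, mem_join] at hx ⊢
    intro i hi
    rw [iter_mem_fib h]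
    exact hg' i hi ((iter_mem_fib h i ω x _).1 (hx i hi))

theorem AC_blocks (h : ∀ p, (Θ p).1 = ϑ p.1) {s : ℕ} {ω : Ω} {M : ℕ → ℕ}
    (hM : ∀ j, AC (iterJoin Θ R s) (iterJoin Θ Q s) (ϑ^[s * j] ω) (M j)) (n : ℕ) (hn : 1 ≤ n) :
    AC (iterJoin Θ R (s * n)) (iterJoin Θ Q (s * n)) ω (∏ j ∈ Finset.range n, M j) := by
  induction n, hn using Nat.le_induction with
  | base => simpa using hM 0
  | succ n hn ih =>
    rw [Finset.prod_range_succ, Nat.mul_succ]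
    exact AC_add h ih (hM n)

theorem Sys.trunc_le (h : Sys P ϑ E Θ) (hE : MeasurableSet E) (hQ : IsRandomCover E Q)
    (hR : IsOpenRandomCover P E R) (hne : R.Nonempty)
    (hfin : ∀ᵐ ω ∂P, ∃ K, Cov E R ω K) {A B : Set Ω} (hA : MeasurableSet A) {s : ℕ} (hs : 1 ≤ s)
    (hB : ∀ ω, ω ∉ B → ∀ i < s, ϑ^[i] ω ∈ A) (n : ℕ) (hn : 1 ≤ n) :
    ∀ᵐ ω ∂P, iterCoverLog Θ R Q (s * n) ω ≤ iterCoverLog Θ (trunc E R A) Q (s * n) ω +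
      ∑ j ∈ Finset.range n, B.indicator (iterCoverLog Θ R Q s) (ϑ^[s * j] ω) := by
  classical
  have hT := trunc_open hE hR hA
  have hfin' : ∀ᵐ ω ∂P, ∃ K, Cov E (trunc E R A) ω K := by
    filter_upwards [hfin] with ω ⟨K, hK⟩
    by_cases hω : ω ∈ A
    · refine ⟨K, hK.refine le_rfl fun u hu => ⟨_, Or.inl ⟨u, hu, rfl⟩, ?_⟩⟩
      intro x hx
      exact ⟨hx, hω⟩
    · refine ⟨1, {E ∩ Prod.fst ⁻¹' Aᶜ}, ?_, by simp, ?_⟩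
      · intro u hu
        right
        simpa using hu
      · intro x hx
        exact mem_iUnion₂.2 ⟨_, Finset.mem_singleton_self _, hx, hω⟩
  filter_upwards [h.ae_AC hQ.2.2.1 hfin, h.ae_AC hQ.2.2.1 hfin'] with ω hω hω'
  have hsn : 1 ≤ s * n := one_le_mul hs hn
  obtain ⟨K, hK⟩ := hω' (s * n) hsn 0
  let M : ℕ → ℕ := fun j => if ϑ^[s * j] ω ∈ B then
    Nm (iterJoin Θ R s) (iterJoin Θ Q s) (ϑ^[s * j] ω) else 1
  have hM1 : ∀ j, 1 ≤ M j := by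
    intro j
    simp only [M]
    split_ifs
    · exact one_le_Nm _ _ _
    · exact le_rfl
  have hM : ∀ j, AC (iterJoin Θ R s) (iterJoin Θ (J2 Q (trunc E R A)) s) (ϑ^[s * j] ω) (M j) := by
    intro j
    simp only [M]
    split_ifs with hj
    · obtain ⟨L, hL⟩ := hω s hs (s * j)
      intro q hq
      have hJ : ∀ u ∈ J2 Q (trunc E R A), ∃ v ∈ Q, u ⊆ v := by
        rintro _ ⟨q, hq, r, hr, rfl⟩
        exact ⟨q, hq, inter_subset_left⟩
      obtain ⟨v, hv, hqv⟩ := iterJoin_refine hJ s q hq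
      exact (AC_Nm hL v hv).refine (fun x hx => hqv hx) fun u hu => ⟨u, hu, le_rfl⟩
    · exact trunc_good h.fst hne (hB _ hj)
  have hbl := AC_blocks h.fst hM n hn
  have hch : AC (iterJoin Θ R (s * n)) (iterJoin Θ Q (s * n)) ω _ :=
    AC_chain (AC_Nm hK) fun q hq u hu => hbl _ (iterJoin_J2 hq hu)
  have hP1 : 1 ≤ ∏ j ∈ Finset.range n, M j := Finset.one_le_prod' fun j _ => hM1 j
  refine (icl_le (one_le_mul (one_le_Nm _ _ _) hP1) hch).trans (le_of_eq ?_)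
  rw [Nat.cast_mul, Real.log_mul, Nat.cast_prod, Real.log_prod]
  · congr 1
    · exact (icl_eq _ _).symm
    · refine Finset.sum_congr rfl fun j _ => ?_
      by_cases hj : ϑ^[s * j] ω ∈ B
      · simp only [M, hj, if_true, indicator_of_mem]
        exact (icl_eq _ _).symm
      · simp [M, hj]
  · intro j _
    exact Nat.cast_ne_zero.2 (Nat.one_le_iff_ne_zero.1 (hM1 j))
  · exact Nat.cast_ne_zero.2 (Nat.one_le_iff_ne_zero.1 (one_le_Nm _ _ _))
  · exact Nat.cast_ne_zero.2 (Nat.one_le_iff_ne_zero.1 hP1)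

theorem Sys.reduce (h : Sys P ϑ E Θ) (hE : MeasurableSet E) (hEc : ∀ ω, IsCompact (fib E ω))
    (hQ : IsRandomCover E Q) (hR : IsOpenRandomCover P E R) (ε : ℝ) (hε : 0 < ε) :
    ∃ R', IsOpenRandomCover P E R' ∧ (∃ K, ∀ᵐ ω ∂P, Cov E R' ω K) ∧
      relCoverEnt P Θ R Q ≤ relCoverEnt P Θ R' Q + ENNReal.ofReal ε := by
  classical
  have hfin := fin_cov hEc hR
  rcases R.eq_empty_or_nonempty with rfl | hne
  · refine ⟨∅, hR, ⟨0, Eventually.of_forall fun ω => ⟨∅, by simp, by simp, ?_⟩⟩, le_self_add⟩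
    simpa using hR.1.2.2.2 ω
  by_cases hS : ∃ s, 1 ≤ s ∧ Integrable (iterCoverLog Θ R Q s) P
  swap
  · refine ⟨{E}, triv_cover P hE, ⟨1, Eventually.of_forall triv_cov⟩, ?_⟩
    have h0 : relCoverEnt P Θ R Q = 0 := by
      unfold relCoverEnt
      have : (fun n : ℕ => ENNReal.ofReal ((∫ ω, iterCoverLog Θ R Q n ω ∂P) / n)) =ᶠ[atTop]
          fun _ => 0 := by
        filter_upwards [eventually_ge_atTop 1] with n hn
        rw [integral_undef fun h' => hS ⟨n, hn, h'⟩]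
        simp
      rw [limsup_congr this, limsup_const]
    rw [h0]
    exact bot_le
  obtain ⟨s, hs, hint⟩ := hS
  obtain ⟨e, rfl⟩ := hR.1.1.exists_eq_range hne
  let F : ℕ → Finset (Set (Ω × X)) := fun k => (Finset.range k).image e
  let A : ℕ → Set Ω := fun k => {ω | fib E ω ⊆ ⋃ u ∈ F k, fib u ω}
  have hA : ∀ k, MeasurableSet (A k) := by
    intro k
    refine meas_cov P hE (F k) fun u hu => ?_
    obtain ⟨i, -, rfl⟩ := Finset.mem_image.1 hu
    exact hR.1.2.1 _ ⟨i, rfl⟩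
  have hAcov : ∀ k, ∀ ω ∈ A k, Cov E (range e) ω k := by
    intro k ω hω
    refine ⟨F k, ?_, ?_, hω⟩
    · intro u hu
      obtain ⟨i, -, rfl⟩ := Finset.mem_image.1 (Finset.mem_coe.1 hu)
      exact ⟨i, rfl⟩
    · exact Finset.card_image_le.trans (by simp)
  let B : ℕ → Set Ω := fun k => ⋃ i ∈ Finset.range s, ϑ^[i] ⁻¹' (A k)ᶜ
  have hBm : ∀ k, MeasurableSet (B k) := fun k =>
    Finset.measurableSet_biUnion _ fun i _ => (h.mp.iterate i).measurable (hA k).compl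
  have hBA : ∀ k ω, ω ∉ B k → ∀ i < s, ϑ^[i] ω ∈ A k := by
    intro k ω hω i hi
    by_contra hcon
    exact hω (mem_iUnion₂.2 ⟨i, Finset.mem_range.2 hi, hcon⟩)
  have hev : ∀ ω, (∃ K, Cov E (range e) ω K) → ∀ᶠ k in atTop, ω ∈ A k := by
    rintro ω ⟨K, G, hG, -, hcov⟩
    have : ∀ u ∈ G, ∃ i, e i = u := fun u hu => hG hu
    choose! idx hidx using this
    filter_upwards [eventually_gt_atTop (G.sup idx)] with k hk
    intro x hx
    obtain ⟨u, hu, hxu⟩ := mem_iUnion₂.1 (hcov hx)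
    refine mem_iUnion₂.2 ⟨u, Finset.mem_image.2 ⟨idx u, ?_, hidx u hu⟩, hxu⟩
    exact Finset.mem_range.2 (lt_of_le_of_lt (Finset.le_sup hu) hk)
  have hlim : Tendsto (fun k => ∫ ω, (B k).indicator (iterCoverLog Θ (range e) Q s) ω ∂P) atTop
      (𝓝 (∫ _, (0 : ℝ) ∂P)) := by
    refine tendsto_integral_of_dominated_convergence (iterCoverLog Θ (range e) Q s) ?_ hint ?_ ?_
    · exact fun k => (hint.aestronglyMeasurable.indicator (hBm k))
    · intro k
      refine Eventually.of_forall fun ω => ?_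
      refine (norm_indicator_le_norm_self _ _).trans (le_of_eq ?_)
      exact Real.norm_of_nonneg (icl_nonneg _ _)
    · filter_upwards [h.ae_orbit hfin] with ω hω
      have h1 : ∀ᶠ k in atTop, ∀ i ∈ Finset.range s, ϑ^[i] ω ∈ A k :=
        (eventually_all_finset _).2 fun i _ => hev _ (hω i)
      refine tendsto_const_nhds.congr' ?_
      filter_upwards [h1] with k hk
      rw [indicator_of_notMem]
      intro hmem
      obtain ⟨i, hi, hi'⟩ := mem_iUnion₂.1 hmem
      exact hi' (hk i hi)
  rw [integral_zero] at hlim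
  obtain ⟨k, hk⟩ := (hlim.eventually_lt_const hε).exists
  set c : ℝ := ∫ ω, (B k).indicator (iterCoverLog Θ (range e) Q s) ω ∂P with hc
  have hbd : ∀ᵐ ω ∂P, Cov E (trunc E (range e) (A k)) ω (k + 1) :=
    Eventually.of_forall (trunc_cov (hAcov k))
  have hT := trunc_open hE hR (hA k)
  refine ⟨trunc E (range e) (A k), hT, ⟨k + 1, hbd⟩, ?_⟩
  have hintn : ∀ n, 1 ≤ n → Integrable (iterCoverLog Θ (range e) Q (s * n)) P := by
    intro n hn
    induction n, hn using Nat.le_induction with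
    | base => simpa using hint
    | succ n hn ih =>
      rw [Nat.mul_succ]
      exact (h.int_add hR.1 hQ hfin (one_le_mul hs hn) hs ih hint).1
  have hgint : Integrable ((B k).indicator (iterCoverLog Θ (range e) Q s)) P :=
    hint.indicator (hBm k)
  have hgc : ∀ j, Integrable (fun ω => (B k).indicator (iterCoverLog Θ (range e) Q s)
      (ϑ^[j] ω)) P := fun j => (h.mp.iterate j).integrable_comp_of_integrable hgint
  have hgi : ∀ j, ∫ ω, (B k).indicator (iterCoverLog Θ (range e) Q s) (ϑ^[j] ω) ∂P = c := by
    intro j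
    have hmp := h.mp.iterate j
    rw [hc]
    conv_rhs => rw [← hmp.map_eq]
    rw [integral_map hmp.measurable.aemeasurable]
    rw [hmp.map_eq]
    exact hgint.aestronglyMeasurable
  have hs0 : (1 : ℝ) ≤ s := by exact_mod_cast hs
  have hmain : ∀ n, 1 ≤ n → relCoverEnt P Θ (range e) Q ≤
      ENNReal.ofReal ((∫ ω, iterCoverLog Θ (trunc E (range e) (A k)) Q (s * n) ω ∂P) /
        (s * n : ℕ)) + ENNReal.ofReal ε := by
    intro n hn
    have hsn : 1 ≤ s * n := one_le_mul hs hn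
    refine (h.ent_le hR.1 hQ hfin hsn (hintn n hn)).trans ?_
    have hi' := h.bdd_int hT.1 hQ hbd hsn
    have h5 : ∫ ω, iterCoverLog Θ (range e) Q (s * n) ω ∂P ≤
        ∫ ω, iterCoverLog Θ (trunc E (range e) (A k)) Q (s * n) ω ∂P + n * c := by
      have hsum : Integrable (fun ω => ∑ j ∈ Finset.range n,
          (B k).indicator (iterCoverLog Θ (range e) Q s) (ϑ^[s * j] ω)) P :=
        integrable_finset_sum _ fun j _ => hgc (s * j)
      have h6 := integral_mono_ae (hintn n hn) (hi'.add hsum)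
        (h.trunc_le hE hQ hR hne hfin (hA k) hs (hBA k) n hn)
      have h7 : ∫ ω, (iterCoverLog Θ (trunc E (range e) (A k)) Q (s * n) + fun ω =>
          ∑ j ∈ Finset.range n, (B k).indicator (iterCoverLog Θ (range e) Q s) (ϑ^[s * j] ω)) ω ∂P
          = ∫ ω, iterCoverLog Θ (trunc E (range e) (A k)) Q (s * n) ω ∂P + n * c := by
        rw [integral_add' hi' hsum, integral_finset_sum _ fun j _ => hgc (s * j)]
        simp [hgi]
      rw [h7] at h6
      exact h6
    rw [← ENNReal.ofReal_add (div_nonneg (integral_nonneg fun ω => icl_nonneg _ _)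
      (Nat.cast_nonneg _)) hε.le]
    apply ENNReal.ofReal_le_ofReal
    have hn0 : (1 : ℝ) ≤ n := by exact_mod_cast hn
    have hsn0 : (0 : ℝ) < (s * n : ℕ) := by exact_mod_cast hsn
    rw [div_add' _ _ _ hsn0.ne']
    refine div_le_div_of_nonneg_right (h5.trans ?_) hsn0.le
    have h8 : (n : ℝ) * c ≤ ε * (s * n : ℕ) := by
      push_cast
      have : (n : ℝ) * c ≤ n * ε := mul_le_mul_of_nonneg_left hk.le (by linarith)
      have : (n : ℝ) * ε ≤ s * (n * ε) := le_mul_of_one_le_left (by positivity) hs0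
      linarith
    linarith
  rw [← tsub_le_iff_right]
  refine le_trans ?_ (limsup_mul_le (fun n : ℕ => ENNReal.ofReal
    ((∫ ω, iterCoverLog Θ (trunc E (range e) (A k)) Q n ω ∂P) / n)) hs)
  refine le_limsup_of_frequently_le (Eventually.frequently ?_) (by isBoundedDefault)
  filter_upwards [eventually_ge_atTop 1] with n hn
  exact tsub_le_iff_right.2 (hmain n hn)

theorem Sys.cond_le (h : Sys P ϑ E Θ) (hE : MeasurableSet E) (hEc : ∀ ω, IsCompact (fib E ω))
    (hQ : IsRandomCover E Q) (c : ℝ≥0∞)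
    (hc : ∀ R, IsOpenRandomCover P E R → (∃ K, ∀ᵐ ω ∂P, Cov E R ω K) → relCoverEnt P Θ R Q ≤ c) :
    condTailEnt P E Θ Q ≤ c := by
  refine iSup₂_le fun R hR => ?_
  refine ENNReal.le_of_forall_pos_le_add fun ε hε _ => ?_
  obtain ⟨R', h1, h2, h3⟩ := h.reduce hE hEc hQ hR ε (by exact_mod_cast hε)
  rw [ENNReal.ofReal_coe_nnreal] at h3
  exact h3.trans (add_le_add_left (hc R' h1 h2) _)

theorem Sys.bdd_join (h : Sys P ϑ E Θ) {K m : ℕ} (hfin : ∀ᵐ ω ∂P, Cov E R ω K) (hm : 1 ≤ m) :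
    ∀ᵐ ω ∂P, Cov E (iterJoin Θ R m) ω (K ^ m) := by
  filter_upwards [h.ae_orbit hfin] with ω hω
  have h1 := AC_prod (Q := {E}) h.fst (by simp) hω m hm
  have h2 : (⋂ i ∈ Finset.range m, Θ^[i] ⁻¹' E) ∈ iterJoin Θ {E} m := ⟨fun _ => E, by simp, rfl⟩
  have h3 := h1 _ h2
  rw [Finset.prod_const, Finset.card_range] at h3
  refine h3.refine ?_ fun u hu => ⟨u, hu, le_rfl⟩
  intro x hx
  exact mem_join.2 fun i _ => h.maps.iterate i hx

theorem Sys.pow_pos (h : Sys P ϑ E Θ) (hE : MeasurableSet E) (hEc : ∀ ω, IsCompact (fib E ω))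
    {m : ℕ} (hm : 1 ≤ m) : tailEnt P E (Θ^[m]) = m * tailEnt P E Θ := by
  have hm0 : (m : ℝ≥0∞) ≠ 0 := Nat.cast_ne_zero.2 (by omega)
  have hmt : (m : ℝ≥0∞) ≠ ⊤ := ENNReal.natCast_ne_top m
  have hi := h.iterate m
  apply le_antisymm
  · rw [mul_comm, ← ENNReal.div_le_iff hm0 hmt]
    refine le_iInf₂ fun Q hQ => ?_
    rw [ENNReal.div_le_iff hm0 hmt, mul_comm]
    have hQm := h.join_cover hQ hm
    refine (iInf₂_le (iterJoin Θ Q m) hQm).trans ?_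
    refine hi.cond_le hE hEc hQm _ ?_
    rintro R hR ⟨K, hK⟩
    have h1 : relCoverEnt P (Θ^[m]) R (iterJoin Θ Q m) ≤
        relCoverEnt P (Θ^[m]) (iterJoin Θ R m) (iterJoin Θ Q m) :=
      hi.ent_refine (h.join_cover hR.1 hm) hQm (h.bdd_join hK hm) (iterJoin_head hm)
        fun u hu => ⟨u, hu, le_rfl⟩
    rw [h.ent_pow hR.1 hQ hK hm] at h1
    refine h1.trans (mul_le_mul_right ?_ _)
    exact le_iSup₂ (f := fun R (_ : R ∈ {R | IsOpenRandomCover P E R}) => relCoverEnt P Θ R Q) R hR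
  · refine le_iInf₂ fun Q hQ => ?_
    rw [mul_comm, ← ENNReal.le_div_iff_mul_le (Or.inl hm0) (Or.inl hmt)]
    refine (iInf₂_le Q hQ).trans ?_
    refine h.cond_le hE hEc hQ _ ?_
    rintro R hR ⟨K, hK⟩
    rw [ENNReal.le_div_iff_mul_le (Or.inl hm0) (Or.inl hmt), mul_comm, ← h.ent_pow hR.1 hQ hK hm]
    have h1 : relCoverEnt P (Θ^[m]) (iterJoin Θ R m) (iterJoin Θ Q m) ≤
        relCoverEnt P (Θ^[m]) (iterJoin Θ R m) Q :=
      hi.ent_refine (h.join_cover hR.1 hm) hQ (h.bdd_join hK hm)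
        (fun u hu => ⟨u, hu, le_rfl⟩) (iterJoin_head hm)
    refine h1.trans ?_
    exact le_iSup₂ (f := fun R (_ : R ∈ {R | IsOpenRandomCover P E R}) =>
      relCoverEnt P (Θ^[m]) R Q) (iterJoin Θ R m) (h.join_open hR hm)

theorem Sys.pow_zero (h : Sys P ϑ E Θ) (hE : MeasurableSet E) (hEc : ∀ ω, IsCompact (fib E ω)) :
    tailEnt P E (Θ^[0]) = 0 := by
  have hi := h.iterate 0
  have hQ := (triv_cover P hE).1
  rw [← nonpos_iff_eq_zero]
  refine (iInf₂_le {E} hQ).trans ?_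
  refine hi.cond_le hE hEc hQ _ ?_
  rintro R hR ⟨K, hK⟩
  have hb : ∀ n : ℕ, 1 ≤ n → relCoverEnt P (Θ^[0]) R {E} ≤
      ENNReal.ofReal (Real.log (max 1 K : ℕ) / n) := by
    intro n hn
    have hint := hi.bdd_int hR.1 hQ hK hn
    refine (hi.ent_le hR.1 hQ (hK.mono fun ω hω => ⟨K, hω⟩) hn hint).trans ?_
    apply ENNReal.ofReal_le_ofReal
    refine div_le_div_of_nonneg_right ?_ (Nat.cast_nonneg _)
    have hle : ∀ᵐ ω ∂P, iterCoverLog (Θ^[0]) R {E} n ω ≤ Real.log (max 1 K : ℕ) := by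
      filter_upwards [hK] with ω hω
      refine icl_le (le_max_left _ _) ?_
      intro q hq
      obtain ⟨v, hv, hqv⟩ := iterJoin_head hn q hq
      have hvE : v = E := by simpa using hv
      subst hvE
      refine (hω.refine (fun x hx => hqv hx) fun u hu => ?_).mono (le_max_right _ _)
      refine ⟨_, ⟨fun _ => u, fun _ => hu, rfl⟩, ?_⟩
      intro x hx
      refine mem_join.2 fun i _ => ?_
      rw [← Function.iterate_mul, Nat.zero_mul]
      exact hx
    have := integral_mono_ae hint (integrable_const _) hle
    simpa using this
  have hlim : Tendsto (fun n : ℕ => ENNReal.ofReal (Real.log (max 1 K : ℕ) / n)) atTop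
      (𝓝 (ENNReal.ofReal 0)) :=
    ENNReal.tendsto_ofReal (tendsto_const_div_atTop_nhds_zero_nat _)
  rw [ENNReal.ofReal_zero] at hlim
  refine ge_of_tendsto hlim ?_
  filter_upwards [eventually_ge_atTop 1] with n hn
  exact hb n hn

end Red

/-- the power rule `h*(Θ^m) = m · h*(Θ)` for the relative tail entropy. -/
theorem tailEnt_pow
    {Ω X : Type*} [MeasurableSpace Ω] [MeasurableSpace.CountablyGenerated Ω]
    [MetricSpace X] [CompactSpace X] [MeasurableSpace X] [BorelSpace X]
    (P : Measure Ω) [IsProbabilityMeasure P] (hP : P.IsComplete)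
    (ϑ : Ω → Ω) (E : Set (Ω × X)) (hE : MeasurableSet E) (hEc : ∀ ω, IsCompact (fib E ω))
    (T : Ω → X → X) (hT : IsBundleRDS P ϑ E T)
    (m : ℕ) :
    tailEnt P E ((skew ϑ T)^[m]) = (m : ℝ≥0∞) * tailEnt P E (skew ϑ T) := by
  have := hP
  have hS : Sys P ϑ E (skew ϑ T) :=
    { fst := fun p => rfl
      mp := hT.measurePreserving
      meas := (hT.measurePreserving.measurable.comp measurable_fst).prodMk hT.measurable
      maps := fun p hp => hT.mapsTo p.1 hp
      cont := hT.continuousOn }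
  rcases Nat.eq_zero_or_pos m with rfl | hm
  · rw [hS.pow_zero hE hEc]
    simp
  · exact hS.pow_pos hE hEc hm

end RelTail
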